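/- Let X be a nonempty compact metric space, m, d ≥ 0 integers, and Y a metric space with the property that every open cover of Y admits an open refinement in which every point lies in at most m+1 sets (this expresses that Y has covering dimension at most m). Then every continuous map f : X → Y has a fiber f⁻¹(y), y ∈ Y, with UW_d(f⁻¹(y)) ≥ UW_{n-1}(X), where n = (m+1)(d+1). -/

import Mathlib

/-- The Urysohn `d`-width of a subset `S` of a metric space `X`, defined as the
infimum, over all covers of `S` by open subsets of `X` of multiplicity at most
`d+1`, of the supremum of the diameters of the covering sets. -/
noncomputable def openWidth {X : Type*} [MetricSpace X] (d : ℕ) (S : Set X) : ℝ :=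
  sInf {w : ℝ | ∃ 𝒰 : Set (Set X),
    (∀ U ∈ 𝒰, IsOpen U) ∧ S ⊆ ⋃₀ 𝒰 ∧
    (∀ x : X, {U ∈ 𝒰 | x ∈ U}.Finite ∧ {U ∈ 𝒰 | x ∈ U}.ncard ≤ d + 1) ∧
    ∀ U ∈ 𝒰, Metric.diam U ≤ w}

theorem exists_cover_of_openWidth_lt {X : Type*} [MetricSpace X] {d : ℕ} {S : Set X} {r : ℝ}
    (h : openWidth d S < r) :
    ∃ w < r, ∃ 𝒰 : Set (Set X), (∀ U ∈ 𝒰, IsOpen U) ∧ S ⊆ ⋃₀ 𝒰 ∧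
      (∀ x : X, {U ∈ 𝒰 | x ∈ U}.Finite ∧ {U ∈ 𝒰 | x ∈ U}.ncard ≤ d + 1) ∧
      ∀ U ∈ 𝒰, Metric.diam U ≤ w := by
  rw [openWidth] at h
  refine (exists_lt_of_csInf_lt ?_ h).imp fun w hw => ⟨hw.2, hw.1⟩
  refine ⟨Metric.diam (Set.univ : Set X), {Set.univ}, by simp, by simp, fun x => ?_, by simp⟩
  have hsub : {U ∈ ({Set.univ} : Set (Set X)) | x ∈ U} ⊆ {Set.univ} := fun U hU => hU.1
  refine ⟨(Set.finite_singleton _).subset hsub, ?_⟩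
  have := Set.ncard_le_ncard hsub (Set.finite_singleton _)
  rw [Set.ncard_singleton] at this
  omega

theorem openWidth_le_of_cover {X : Type*} [MetricSpace X] {d : ℕ} {S : Set X}
    (hS : S.Nonempty) {w : ℝ} {𝒰 : Set (Set X)} (hopen : ∀ U ∈ 𝒰, IsOpen U) (hcov : S ⊆ ⋃₀ 𝒰)
    (hmult : ∀ x : X, {U ∈ 𝒰 | x ∈ U}.Finite ∧ {U ∈ 𝒰 | x ∈ U}.ncard ≤ d + 1)
    (hdiam : ∀ U ∈ 𝒰, Metric.diam U ≤ w) : openWidth d S ≤ w := by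
  refine csInf_le ⟨0, ?_⟩ ⟨𝒰, hopen, hcov, hmult, hdiam⟩
  rintro v ⟨𝒲, -, hc, -, hd⟩
  obtain ⟨x, hx⟩ := hS
  obtain ⟨W, hW, -⟩ := hc hx
  exact Metric.diam_nonneg.trans (hd W hW)

/-- Refining the sets `f⁻¹ V` of a pulled-back family of multiplicity at most `a` by families of
multiplicity at most `b` gives multiplicity at most `a * b`. -/
theorem ncard_preimage_inter_le {X Y : Type*} (f : X → Y) {a b : ℕ} {𝒱 : Set (Set Y)}
    {𝒰 : Set Y → Set (Set X)} {x : X}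
    (hV : {V ∈ 𝒱 | f x ∈ V}.Finite ∧ {V ∈ 𝒱 | f x ∈ V}.ncard ≤ a)
    (hU : ∀ V, {U ∈ 𝒰 V | x ∈ U}.Finite ∧ {U ∈ 𝒰 V | x ∈ U}.ncard ≤ b) :
    {W ∈ {W | ∃ V ∈ 𝒱, ∃ U ∈ 𝒰 V, W = f ⁻¹' V ∩ U} | x ∈ W}.Finite ∧
      {W ∈ {W | ∃ V ∈ 𝒱, ∃ U ∈ 𝒰 V, W = f ⁻¹' V ∩ U} | x ∈ W}.ncard ≤ a * b := by
  classical
  let F : Finset (Set X) := hV.1.toFinset.biUnion fun V =>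
    (hU V).1.toFinset.image fun U => f ⁻¹' V ∩ U
  have hsub : {W ∈ {W | ∃ V ∈ 𝒱, ∃ U ∈ 𝒰 V, W = f ⁻¹' V ∩ U} | x ∈ W} ⊆ (F : Set (Set X)) := by
    rintro W ⟨⟨V, hV', U, hU', rfl⟩, hxV, hxU⟩
    simp only [F, Finset.mem_coe, Finset.mem_biUnion, Finset.mem_image, Set.Finite.mem_toFinset]
    exact ⟨V, ⟨hV', hxV⟩, U, ⟨hU', hxU⟩, rfl⟩
  refine ⟨F.finite_toSet.subset hsub, ?_⟩
  calc _ ≤ F.card := by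
        simpa using Set.ncard_le_ncard hsub F.finite_toSet
    _ ≤ hV.1.toFinset.card * b := by
        refine Finset.card_biUnion_le_card_mul _ _ _ fun V _ => Finset.card_image_le.trans ?_
        rw [← Set.ncard_eq_toFinset_card _ (hU V).1]
        exact (hU V).2
    _ ≤ a * b := by
        gcongr
        rw [← Set.ncard_eq_toFinset_card _ hV.1]
        exact hV.2

theorem exists_isOpen_preimage_subset {X Y : Type*} [TopologicalSpace X] [CompactSpace X]
    [TopologicalSpace Y] [T2Space Y] {f : X → Y} (hf : Continuous f) {O : Set X} (hO : IsOpen O)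
    {y : Y} (hy : f ⁻¹' {y} ⊆ O) : ∃ N : Set Y, IsOpen N ∧ y ∈ N ∧ f ⁻¹' N ⊆ O := by
  refine ⟨(f '' Oᶜ)ᶜ, (hO.isClosed_compl.isCompact.image hf).isClosed.isOpen_compl, ?_, ?_⟩
  · rintro ⟨x, hx, rfl⟩
    exact hx (hy rfl)
  · intro x hx
    by_contra hxO
    exact hx ⟨x, hxO, rfl⟩

/-- (Gromov) Let `X` be a nonempty compact metric space and `Y` a metric space of
covering dimension at most `m` (every open cover of `Y` admits an open refinement
of multiplicity at most `m+1`).  Then every continuous map `f : X → Y` has a fiber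
`f⁻¹ y` with `UW_d (f⁻¹ y) ≥ UW_{n-1} (X)`, where `n = (m+1)(d+1)`. -/
theorem exists_fiber_large_width {X Y : Type*} [MetricSpace X] [CompactSpace X]
    [Nonempty X] [MetricSpace Y] (m d : ℕ)
    (hY : ∀ 𝒰 : Set (Set Y), (∀ U ∈ 𝒰, IsOpen U) → ⋃₀ 𝒰 = Set.univ →
      ∃ 𝒱 : Set (Set Y), (∀ V ∈ 𝒱, IsOpen V) ∧ ⋃₀ 𝒱 = Set.univ ∧
        (∀ V ∈ 𝒱, ∃ U ∈ 𝒰, V ⊆ U) ∧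
        ∀ z : Y, {V ∈ 𝒱 | z ∈ V}.Finite ∧ {V ∈ 𝒱 | z ∈ V}.ncard ≤ m + 1)
    (f : X → Y) (hf : Continuous f) :
    ∃ y : Y, openWidth ((m + 1) * (d + 1) - 1) (Set.univ : Set X) ≤
      openWidth d (f ⁻¹' {y}) := by
  by_contra! hlt
  choose w hw 𝒰 hopen hcov hmult hdiam using fun x : X => exists_cover_of_openWidth_lt (hlt (f x))
  choose N hNopen hxN hN using fun x : X =>
    exists_isOpen_preimage_subset hf (isOpen_sUnion (hopen x)) (hcov x)
  obtain ⟨t, ht⟩ := isCompact_univ.elim_finite_subcover (fun x => f ⁻¹' N x)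
    (fun x => (hNopen x).preimage hf) fun x _ => Set.mem_iUnion.2 ⟨x, hxN x⟩
  have ht' : ∀ x, ∃ p ∈ t, f x ∈ N p := fun x => by simpa using ht (Set.mem_univ x)
  obtain ⟨𝒱, h𝒱open, h𝒱cov, h𝒱ref, h𝒱mult⟩ := hY (insert (Set.range f)ᶜ (N '' t))
    (by
      rintro U (rfl | ⟨x, -, rfl⟩)
      · exact (isCompact_range hf).isClosed.isOpen_compl
      · exact hNopen x)
    (by
      refine Set.eq_univ_of_forall fun y => ?_
      by_cases hy : y ∈ Set.range f
      · obtain ⟨x, rfl⟩ := hy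
        obtain ⟨p, hp, hxp⟩ := ht' x
        exact ⟨N p, Or.inr ⟨p, hp, rfl⟩, hxp⟩
      · exact ⟨_, Or.inl rfl, hy⟩)
  have hcenter : ∀ V : Set Y, ∃ p ∈ t, V ∈ 𝒱 → f ⁻¹' V ⊆ ⋃₀ 𝒰 p := by
    intro V
    obtain ⟨p₀, hp₀, -⟩ := ht' (Classical.arbitrary X)
    by_cases hV : V ∈ 𝒱
    · obtain ⟨U, rfl | ⟨p, hp, rfl⟩, hVU⟩ := h𝒱ref V hV
      · exact ⟨p₀, hp₀, fun _ x hx => absurd ⟨x, rfl⟩ (hVU hx)⟩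
      · exact ⟨p, hp, fun _ => (Set.preimage_mono hVU).trans (hN p)⟩
    · exact ⟨p₀, hp₀, fun h => absurd h hV⟩
  choose g hgt hg using hcenter
  obtain ⟨q, -, hq⟩ := t.exists_max_image w
    (let ⟨p, hp, _⟩ := ht' (Classical.arbitrary X); ⟨p, hp⟩)
  refine (hw q).not_ge (openWidth_le_of_cover Set.univ_nonempty
    (𝒰 := {W | ∃ V ∈ 𝒱, ∃ U ∈ 𝒰 (g V), W = f ⁻¹' V ∩ U}) ?_ ?_ ?_ ?_)
  · rintro _ ⟨V, hV, U, hU, rfl⟩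
    exact ((h𝒱open V hV).preimage hf).inter (hopen _ U hU)
  · intro x _
    obtain ⟨V, hV, hxV⟩ : f x ∈ ⋃₀ 𝒱 := h𝒱cov ▸ Set.mem_univ _
    obtain ⟨U, hU, hxU⟩ := hg V hV hxV
    exact ⟨_, ⟨V, hV, U, hU, rfl⟩, hxV, hxU⟩
  · intro x
    rw [Nat.sub_add_cancel (Nat.mul_pos m.succ_pos d.succ_pos)]
    exact ncard_preimage_inter_le f (h𝒱mult (f x)) fun V => hmult (g V) x
  · rintro _ ⟨V, -, U, hU, rfl⟩
    exact (Metric.diam_mono Set.inter_subset_right (Metric.isBounded_of_compactSpace)).trans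
      ((hdiam _ U hU).trans (hq _ (hgt V)))
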